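/- arXiv:1206.5766 — 2 statements merged into one kernel-verified Lean document; each statement's English description precedes it below -/
import Mathlib

section
/- In the mixture of spherical Gaussians model, let σ̄² := Σ_{i=1}^k w_i σ_i², let v be any unit-norm eigenvector of the covariance matrix of x with eigenvalue σ̄², and let M_1 := E[x (vᵀ(x − E[x]))²]. Then the third-order tensor M_3 := E[x ⊗ x ⊗ x] − Σ_{j=1}^d ( M_1 ⊗ e_j ⊗ e_j + e_j ⊗ M_1 ⊗ e_j + e_j ⊗ e_j ⊗ M_1 ) equals Σ_{i=1}^k w_i μ_i ⊗ μ_i ⊗ μ_i. -/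
open MeasureTheory ProbabilityTheory Matrix
open scoped BigOperators NNReal

/-- `f` is integrable with integral `c`. -/
def HI {α : Type*} [MeasurableSpace α] (ν : Measure α) (f : α → ℝ) (c : ℝ) : Prop :=
  Integrable f ν ∧ ∫ y, f y ∂ν = c

namespace HI

variable {α : Type*} [MeasurableSpace α] {ν : Measure α} {f g : α → ℝ} {c c' : ℝ}

lemma add (hf : HI ν f c) (hg : HI ν g c') : HI ν (fun y => f y + g y) (c + c') :=
  ⟨hf.1.add hg.1, by rw [integral_add hf.1 hg.1, hf.2, hg.2]⟩

lemma cmul (r : ℝ) (hf : HI ν f c) : HI ν (fun y => r * f y) (r * c) :=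
  ⟨hf.1.const_mul r, by rw [integral_const_mul, hf.2]⟩

lemma const [IsProbabilityMeasure ν] (r : ℝ) : HI ν (fun _ => r) r :=
  ⟨integrable_const r, by simp⟩

lemma sum {ι : Type*} (s : Finset ι) {F : ι → α → ℝ} {C : ι → ℝ}
    (hF : ∀ i, HI ν (F i) (C i)) : HI ν (fun y => ∑ i ∈ s, F i y) (∑ i ∈ s, C i) :=
  ⟨integrable_finsetSum s fun i _ => (hF i).1, by
    rw [integral_finsetSum s fun i _ => (hF i).1]
    exact Finset.sum_congr rfl fun i _ => (hF i).2⟩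

lemma of_eq (hf : HI ν f c) (h1 : ∀ y, g y = f y) (h2 : c' = c) : HI ν g c' := by
  have : g = f := funext h1
  rw [this, h2]; exact hf

end HI

lemma gauss_int (m : ℝ) (s : ℝ≥0) (n : ℕ) :
    Integrable (fun t => (t - m) ^ n) (gaussianReal m s) := by
  have h : MemLp (fun t : ℝ => t - m) (n : ENNReal) (gaussianReal m s) :=
    (memLp_id_gaussianReal' (n : ENNReal) (by simp)).sub (memLp_const m)
  refine (integrable_norm_iff (by fun_prop)).1 ?_
  simpa only [norm_pow] using MemLp.integrable_norm_pow' h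

lemma gauss_symm (m : ℝ) (s : ℝ≥0) (n : ℕ) :
    ∫ t, (t - m) ^ n ∂(gaussianReal m s) = (-1) ^ n * ∫ t, (t - m) ^ n ∂(gaussianReal m s) := by
  have h : (gaussianReal m s).map (fun t => 2 * m - t) = gaussianReal m s := by
    rw [gaussianReal_map_const_sub]; congr 1; ring
  conv_lhs => rw [← h]
  rw [integral_map (by fun_prop) (by fun_prop), ← integral_const_mul]
  congr 1; ext t
  rw [← mul_pow]; congr 1; ring

lemma gauss_var (m : ℝ) (s : ℝ≥0) : ∫ t, (t - m) ^ 2 ∂(gaussianReal m s) = s := by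
  have h := variance_fun_id_gaussianReal (μ := m) (v := s)
  rwa [variance_eq_integral (by fun_prop), integral_id_gaussianReal] at h

section pi
variable {d : ℕ} (m : Fin d → ℝ) (s : ℝ≥0)

lemma pi_mono (n : Fin d → ℕ) :
    HI (Measure.pi fun j => gaussianReal (m j) s) (fun y => ∏ j, (y j - m j) ^ n j)
      (∏ j, ∫ t, (t - m j) ^ n j ∂(gaussianReal (m j) s)) :=
  ⟨Integrable.fintype_prod fun j => gauss_int (m j) s (n j),
    integral_fintype_prod_eq_prod (fun j t => (t - m j) ^ n j)⟩

lemma pi_odd (n : Fin d → ℕ) (hn : Odd (∑ j, n j)) :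
    HI (Measure.pi fun j => gaussianReal (m j) s) (fun y => ∏ j, (y j - m j) ^ n j) 0 := by
  refine (pi_mono m s n).of_eq (fun _ => rfl) ?_
  have h : (∏ j, ∫ t, (t - m j) ^ n j ∂(gaussianReal (m j) s))
      = (-1) ^ (∑ j, n j) * ∏ j, ∫ t, (t - m j) ^ n j ∂(gaussianReal (m j) s) := by
    conv_lhs => rw [Finset.prod_congr rfl fun j _ => gauss_symm (m j) s (n j)]
    rw [Finset.prod_mul_distrib, Finset.prod_pow_eq_pow_sum]
  rw [hn.neg_one_pow] at h
  linarith

lemma pi_one (a : Fin d) :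
    HI (Measure.pi fun j => gaussianReal (m j) s) (fun y => y a - m a) 0 := by
  refine (pi_odd m s (fun j => if j = a then 1 else 0) (by simp)).of_eq (fun y => ?_) rfl
  simp [pow_ite]

lemma pi_three (a b c : Fin d) :
    HI (Measure.pi fun j => gaussianReal (m j) s)
      (fun y => (y a - m a) * (y b - m b) * (y c - m c)) 0 := by
  refine (pi_odd m s (fun j => (if j = a then 1 else 0) + (if j = b then 1 else 0)
    + (if j = c then 1 else 0)) ?_).of_eq (fun y => ?_) rfl
  · simp [Finset.sum_add_distrib]; decide
  · simp only [pow_add, Finset.prod_mul_distrib]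
    simp [pow_ite]

lemma pi_two (a b : Fin d) :
    HI (Measure.pi fun j => gaussianReal (m j) s)
      (fun y => (y a - m a) * (y b - m b)) (if a = b then (s : ℝ) else 0) := by
  refine (pi_mono m s (fun j => (if j = a then 1 else 0) + (if j = b then 1 else 0))).of_eq
    (fun y => ?_) ?_
  · simp only [pow_add, Finset.prod_mul_distrib]
    simp [pow_ite]
  · split_ifs with hab
    · subst hab
      rw [Finset.prod_eq_single a]
      · simp [← gauss_var (m a) s]
      · intro j _ hj; simp [hj]
      · simp
    · symm
      apply Finset.prod_eq_zero (Finset.mem_univ a)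
      have := gauss_symm (m a) s 1
      simp only [hab, if_true, if_false, Nat.add_zero]
      linarith

lemma pi_raw1 (a : Fin d) :
    HI (Measure.pi fun j => gaussianReal (m j) s) (fun y => y a) (m a) :=
  ((pi_one m s a).add (HI.const (m a))).of_eq (fun y => by ring) (by ring)

lemma pi_raw2 (u : Fin d → ℝ) (a b : Fin d) :
    HI (Measure.pi fun j => gaussianReal (m j) s) (fun y => (y a - u a) * (y b - u b))
      ((m a - u a) * (m b - u b) + if a = b then (s : ℝ) else 0) :=
  (((pi_two m s a b).add ((pi_one m s a).cmul (m b - u b))).add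
    (((pi_one m s b).cmul (m a - u a)).add (HI.const ((m a - u a) * (m b - u b))))).of_eq
    (fun y => by ring) (by ring)

lemma pi_raw3 (a b c : Fin d) :
    HI (Measure.pi fun j => gaussianReal (m j) s) (fun y => y a * y b * y c)
      (m a * m b * m c + s * ((if a = b then m c else 0) + (if a = c then m b else 0)
        + (if b = c then m a else 0))) := by
  refine ((((pi_three m s a b c).add ((pi_two m s a b).cmul (m c))).add
    (((pi_two m s a c).cmul (m b)).add ((pi_two m s b c).cmul (m a)))).add
    ((((pi_one m s a).cmul (m b * m c)).add ((pi_one m s b).cmul (m a * m c))).add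
    (((pi_one m s c).cmul (m a * m b)).add (HI.const (m a * m b * m c))))).of_eq
    (fun y => by ring) ?_
  split_ifs <;> ring

lemma pi_M1 (v u : Fin d → ℝ) (hv : v ⬝ᵥ v = 1) (hu : ∑ r, v r * (m r - u r) = 0) (a : Fin d) :
    HI (Measure.pi fun j => gaussianReal (m j) s)
      (fun y => y a * (v ⬝ᵥ (fun r => y r - u r)) ^ 2) (s * m a) := by
  have key := HI.sum Finset.univ fun r => HI.sum Finset.univ fun q =>
    ((pi_three m s a r q).add ((pi_two m s r q).cmul (m a))).cmul (v r * v q)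
  refine key.of_eq (fun y => ?_) ?_
  · have : (v ⬝ᵥ fun r => y r - u r) = ∑ r, v r * (y r - m r) := by
      rw [dotProduct, ← add_zero (∑ r, v r * (y r - m r)), ← hu, ← Finset.sum_add_distrib]
      exact Finset.sum_congr rfl fun r _ => by ring
    rw [this, sq, Finset.sum_mul_sum, Finset.mul_sum]
    refine Finset.sum_congr rfl fun r _ => ?_
    rw [Finset.mul_sum]
    exact Finset.sum_congr rfl fun q _ => by ring
  · simp only [mul_ite, mul_zero, zero_add, Finset.sum_ite_eq, Finset.mem_univ, if_true]
    rw [dotProduct] at hv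
    rw [← Finset.sum_mul, hv]; ring

end pi

lemma mix_integral {Ω : Type} [MeasurableSpace Ω] (P : Measure Ω) [IsProbabilityMeasure P]
    {d k : ℕ} (w : Fin k → ℝ) (ν : Fin k → Measure (Fin d → ℝ))
    (h : Ω → Fin k) (x : Ω → Fin d → ℝ)
    (hmeas_h : Measurable h) (hmeas_x : Measurable x)
    (hw_pos : ∀ i, 0 < w i)
    (hprob : ∀ i, P (h ⁻¹' {i}) = ENNReal.ofReal (w i))
    (hcond : ∀ i, (ProbabilityTheory.cond P (h ⁻¹' {i})).map x = ν i)
    (f : (Fin d → ℝ) → ℝ) (hf : Measurable f) (c : Fin k → ℝ) (hc : ∀ i, HI (ν i) f (c i)) :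
    ∫ ω, f (x ω) ∂P = ∑ i, w i * c i := by
  have hi : ∀ i, Integrable (fun ω => f (x ω)) (ProbabilityTheory.cond P (h ⁻¹' {i})) := by
    intro i
    have := (hc i).1
    rw [← hcond i] at this
    exact this.comp_measurable hmeas_x
  have hP := sum_meas_smul_cond_fiber hmeas_h P
  conv_lhs => rw [← hP]
  rw [integral_finsetSum_measure]
  · refine Finset.sum_congr rfl fun i _ => ?_
    rw [integral_smul_measure, hprob, ENNReal.toReal_ofReal (hw_pos i).le, smul_eq_mul,
      ← (hc i).2, ← hcond i, integral_map hmeas_x.aemeasurable hf.aestronglyMeasurable]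
  · intro i _
    exact (hi i).smul_measure (by finiteness)

/-- **Observable moment structure (third order).**
In the mixture of spherical Gaussians model, with `σ̄² = ∑ i, w i σ_i²`, `v` any unit-norm
eigenvector of the covariance matrix with eigenvalue `σ̄²`, and
`M₁ := E[x (vᵀ(x − E[x]))²]`, the third-order tensor
`M₃ := E[x ⊗ x ⊗ x] − ∑_j (M₁ ⊗ e_j ⊗ e_j + e_j ⊗ M₁ ⊗ e_j + e_j ⊗ e_j ⊗ M₁)`
equals `∑ i, w i • μ i ⊗ μ i ⊗ μ i`. -/
theorem mixture_moments_M3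
    {Ω : Type} [MeasurableSpace Ω] (P : Measure Ω) [IsProbabilityMeasure P]
    (d k : ℕ) (w : Fin k → ℝ) (μ : Fin k → Fin d → ℝ) (σ2 : Fin k → ℝ≥0)
    (h : Ω → Fin k) (x : Ω → Fin d → ℝ)
    (hmeas_h : Measurable h) (hmeas_x : Measurable x)
    (hw_pos : ∀ i, 0 < w i) (hw_sum : ∑ i, w i = 1)
    (hprob : ∀ i, P (h ⁻¹' {i}) = ENNReal.ofReal (w i))
    (hcond : ∀ i, (ProbabilityTheory.cond P (h ⁻¹' {i})).map x
        = Measure.pi fun j => ProbabilityTheory.gaussianReal (μ i j) (σ2 i))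
    (hrank : (Matrix.of fun (r : Fin d) (c : Fin k) => μ c r).rank = k)
    (μbar : Fin d → ℝ) (hμbar : ∀ i, μbar i = ∫ ω, x ω i ∂P)
    (σbar2 : ℝ) (hσbar2 : σbar2 = ∑ i, w i * (σ2 i : ℝ))
    (Cov : Matrix (Fin d) (Fin d) ℝ)
    (hCov : Cov = Matrix.of fun i j => ∫ ω, (x ω i - μbar i) * (x ω j - μbar j) ∂P)
    (v : Fin d → ℝ) (hv_unit : v ⬝ᵥ v = 1) (hv_eig : Cov *ᵥ v = σbar2 • v)
    (M1 : Fin d → ℝ)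
    (hM1 : ∀ i, M1 i = ∫ ω, x ω i * (v ⬝ᵥ (fun r => x ω r - μbar r)) ^ 2 ∂P)
    -- the coordinate basis of ℝ^d
    (e : Fin d → Fin d → ℝ) (he : ∀ j, e j = Pi.single j 1)
    (M3 : Fin d → Fin d → Fin d → ℝ)
    (hM3 : ∀ a b c, M3 a b c = (∫ ω, x ω a * x ω b * x ω c ∂P)
        - ∑ j, (M1 a * e j b * e j c + e j a * M1 b * e j c + e j a * e j b * M1 c)) :
    ∀ a b c, M3 a b c = ∑ i, w i * (μ i a * μ i b * μ i c) := by
  have mix := mix_integral P w (fun i => Measure.pi fun j => gaussianReal (μ i j) (σ2 i)) h x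
    hmeas_h hmeas_x hw_pos hprob hcond
  have hbar : ∀ a, μbar a = ∑ i, w i * μ i a := fun a => by
    rw [hμbar]
    exact mix (fun y => y a) (by fun_prop) _ fun i => pi_raw1 (μ i) (σ2 i) a
  have hcov : ∀ a b, Cov a b
      = ∑ i, w i * ((μ i a - μbar a) * (μ i b - μbar b) + if a = b then (σ2 i : ℝ) else 0) :=
    fun a b => by
      rw [hCov]
      exact mix (fun y => (y a - μbar a) * (y b - μbar b)) (by fun_prop) _
        fun i => pi_raw2 (μ i) (σ2 i) μbar a b
  have hquad : v ⬝ᵥ (Cov *ᵥ v) = σbar2 := by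
    rw [hv_eig, dotProduct_smul, hv_unit]; simp
  have hquad2 : v ⬝ᵥ (Cov *ᵥ v)
      = ∑ i, w i * (∑ r, v r * (μ i r - μbar r)) ^ 2 + σbar2 := by
    have e1 : ∀ a b, Cov a b = ∑ i, w i * ((μ i a - μbar a) * (μ i b - μbar b))
        + if a = b then σbar2 else 0 := fun a b => by
      rw [hcov]
      split_ifs <;> simp [mul_add, Finset.sum_add_distrib, hσbar2]
    have e2 : ∀ a, (Cov *ᵥ v) a
        = ∑ i, w i * ((μ i a - μbar a) * ∑ r, v r * (μ i r - μbar r)) + σbar2 * v a := fun a => by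
      simp only [mulVec, dotProduct, e1, add_mul, Finset.sum_add_distrib, ite_mul, zero_mul,
        Finset.sum_ite_eq, Finset.mem_univ, if_true]
      congr 1
      simp only [Finset.sum_mul, Finset.mul_sum]
      rw [Finset.sum_comm]
      exact Finset.sum_congr rfl fun i _ => Finset.sum_congr rfl fun r _ => by ring
    have e3 : ∑ a, v a * (σbar2 * v a) = σbar2 := by
      rw [dotProduct] at hv_unit
      conv_rhs => rw [← mul_one σbar2, ← hv_unit, Finset.mul_sum]
      exact Finset.sum_congr rfl fun r _ => by ring
    rw [dotProduct]
    simp only [e2, mul_add, Finset.sum_add_distrib]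
    rw [e3]
    congr 1
    simp only [Finset.mul_sum (ι := Fin k)]
    rw [Finset.sum_comm]
    refine Finset.sum_congr rfl fun i _ => ?_
    rw [sq, ← mul_assoc, Finset.mul_sum]
    exact Finset.sum_congr rfl fun r _ => by ring
  have hz : ∑ i, w i * (∑ r, v r * (μ i r - μbar r)) ^ 2 = 0 := by linarith
  have horth : ∀ i, ∑ r, v r * (μ i r - μbar r) = 0 := fun i => by
    rw [Finset.sum_eq_zero_iff_of_nonneg
      fun i _ => mul_nonneg (hw_pos i).le (sq_nonneg _)] at hz
    have := hz i (Finset.mem_univ i)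
    simpa [(hw_pos i).ne'] using this
  have hm1 : ∀ a, M1 a = ∑ i, w i * (σ2 i * μ i a) := fun a => by
    rw [hM1]
    refine mix (fun y => y a * (v ⬝ᵥ (fun r => y r - μbar r)) ^ 2) ?_ _
      fun i => pi_M1 (μ i) (σ2 i) v μbar hv_unit (horth i) a
    unfold dotProduct
    fun_prop
  intro a b c
  have h3 : ∫ ω, x ω a * x ω b * x ω c ∂P = _ := mix (fun y => y a * y b * y c) (by fun_prop) _
    fun i => pi_raw3 (μ i) (σ2 i) a b c
  have hsum : ∑ j, (M1 a * e j b * e j c + e j a * M1 b * e j c + e j a * e j b * M1 c)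
      = (if b = c then M1 a else 0) + (if a = c then M1 b else 0)
        + (if a = b then M1 c else 0) := by
    simp only [he, Pi.single_apply, Finset.sum_add_distrib, mul_ite, mul_one, mul_zero,
      ite_mul, one_mul, zero_mul, Finset.sum_ite_eq, Finset.mem_univ, if_true]
  rw [hM3, h3, hsum, hm1, hm1, hm1]
  simp only [mul_add, Finset.sum_add_distrib]
  split_ifs <;> (try simp only [Finset.sum_const_zero, mul_zero]) <;> ring
end

section
/- In the mixture of spherical Gaussians model with common variance σ², let μ := E[x], Σ₂ := E[xxᵀ], Σ₃ := E[x⊗x⊗x], and M_3 := Σ_{i=1}^k w_i μ_i⊗μ_i⊗μ_i, so that M_3 = Σ₃ − σ² Σ_{j=1}^d (μ⊗e_j⊗e_j + e_j⊗μ⊗e_j + e_j⊗e_j⊗μ). Let μ̂ ∈ ℝ^d, let Σ̂₃ be any tensor in ℝ^{d×d×d}, let σ̂² ∈ ℝ satisfy |σ̂² − σ²| ≤ ‖Σ̂₂ − Σ₂‖₂ + 2‖μ‖₂‖μ̂ − μ‖₂ + ‖μ̂ − μ‖₂² for some symmetric Σ̂₂ ∈ ℝ^{d×d}, and define M̂_3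 := Σ̂₃ − σ̂² Σ_{j=1}^d (μ̂⊗e_j⊗e_j + e_j⊗μ̂⊗e_j + e_j⊗e_j⊗μ̂). Then for any matrix R ∈ ℝ^{d×r}: ‖(M̂_3 − M_3)[R,R,R]‖₂ ≤ ‖(Σ̂₃ − Σ₃)[R,R,R]‖₂ + 3‖R‖₂²(‖Rᵀ(μ̂ − μ)‖₂ + ‖Rᵀμ‖₂)·(‖Σ̂₂ − Σ₂‖₂ + 2‖μ‖₂‖μ̂ − μ‖₂ + ‖μ̂ − μ‖₂²) + 3σ²‖R‖₂²‖Rᵀ(μ̂ − μ)‖₂. -/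
open MeasureTheory ProbabilityTheory Matrix
open scoped BigOperators NNReal

/-- Euclidean (ℓ²) norm of a vector in `Fin m → ℝ`. -/
noncomputable def l2norm {m : ℕ} (v : Fin m → ℝ) : ℝ :=
  Real.sqrt (∑ i, v i ^ 2)

/-- Spectral norm (ℓ² operator norm) of a real matrix. -/
noncomputable def spec {m n : ℕ} (M : Matrix (Fin m) (Fin n) ℝ) : ℝ :=
  ‖LinearMap.toContinuousLinearMap (Matrix.toEuclideanLin M)‖

/-- Multilinear contraction `Y[R,R,R]` of a third-order tensor along a matrix. -/
def tmap3 {d r : ℕ} (Y : Fin d → Fin d → Fin d → ℝ) (R1 R2 R3 : Matrix (Fin d) (Fin r) ℝ) :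
    Fin r → Fin r → Fin r → ℝ :=
  fun j1 j2 j3 => ∑ i1, ∑ i2, ∑ i3, R1 i1 j1 * R2 i2 j2 * R3 i3 j3 * Y i1 i2 i3

/-- Operator (supremum) norm of a third-order tensor. -/
noncomputable def tnorm {d : ℕ} (Y : Fin d → Fin d → Fin d → ℝ) : ℝ :=
  sSup {a | ∃ u v w : Fin d → ℝ, l2norm u = 1 ∧ l2norm v = 1 ∧ l2norm w = 1 ∧
    a = |∑ i1, ∑ i2, ∑ i3, u i1 * v i2 * w i3 * Y i1 i2 i3|}

section helpers

lemma aux_l2 {m : ℕ} (v : Fin m → ℝ) : l2norm v = ‖(WithLp.toLp 2 v : EuclideanSpace ℝ (Fin m))‖ := by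
  rw [EuclideanSpace.norm_eq]; simp [l2norm]

lemma aux_l2_nonneg {m : ℕ} (v : Fin m → ℝ) : 0 ≤ l2norm v := Real.sqrt_nonneg _

lemma aux_l2_add {m : ℕ} (u v : Fin m → ℝ) : l2norm (u + v) ≤ l2norm u + l2norm v := by
  simp only [aux_l2, WithLp.toLp_add]; exact norm_add_le _ _

lemma aux_dot {m : ℕ} (u v : Fin m → ℝ) : |u ⬝ᵥ v| ≤ l2norm u * l2norm v := by
  have := abs_real_inner_le_norm (WithLp.toLp 2 v : EuclideanSpace ℝ (Fin m)) (WithLp.toLp 2 u)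
  rw [EuclideanSpace.inner_toLp_toLp] at this
  simpa [aux_l2, mul_comm] using this

lemma aux_spec {m n : ℕ} (R : Matrix (Fin m) (Fin n) ℝ) (u : Fin n → ℝ) :
    l2norm (R *ᵥ u) ≤ spec R * l2norm u := by
  have := (LinearMap.toContinuousLinearMap (Matrix.toEuclideanLin R)).le_opNorm (WithLp.toLp 2 u)
  simpa [aux_l2, spec, Matrix.toLpLin_toLp] using this

lemma aux_spec_nonneg {m n : ℕ} (R : Matrix (Fin m) (Fin n) ℝ) : 0 ≤ spec R := norm_nonneg _

lemma aux_coord {m : ℕ} (u : Fin m → ℝ) (i : Fin m) : |u i| ≤ l2norm u := by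
  rw [aux_l2]
  simpa using PiLp.norm_apply_le (WithLp.toLp 2 u : EuclideanSpace ℝ (Fin m)) i

def auxB {d : ℕ} (Y : Fin d → Fin d → Fin d → ℝ) (u v w : Fin d → ℝ) : ℝ :=
  ∑ i1, ∑ i2, ∑ i3, u i1 * v i2 * w i3 * Y i1 i2 i3

lemma aux_B_map {d r : ℕ} (Y : Fin d → Fin d → Fin d → ℝ) (R : Matrix (Fin d) (Fin r) ℝ)
    (u v w : Fin r → ℝ) :
    auxB (tmap3 Y R R R) u v w = auxB Y (R *ᵥ u) (R *ᵥ v) (R *ᵥ w) := by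
  have h1 : ∀ (Z : Fin r → Fin r → Fin r → ℝ), auxB Z u v w
      = ∑ p : Fin r × Fin r × Fin r, u p.1 * v p.2.1 * w p.2.2 * Z p.1 p.2.1 p.2.2 := by
    intro Z; simp [auxB, Fintype.sum_prod_type]
  have h2 : ∀ (f : Fin d → Fin d → Fin d → ℝ), ∑ a, ∑ b, ∑ c, f a b c
      = ∑ p : Fin d × Fin d × Fin d, f p.1 p.2.1 p.2.2 := by
    intro f; simp [Fintype.sum_prod_type]
  rw [h1]
  unfold auxB tmap3
  simp only [h2, Finset.mul_sum]
  rw [Finset.sum_comm]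
  refine Finset.sum_congr rfl fun q _ => ?_
  simp only [Matrix.mulVec, dotProduct, Fintype.sum_prod_type, Finset.sum_mul_sum, Finset.sum_mul]
  refine Finset.sum_congr rfl fun a _ => ?_
  rw [Finset.mul_sum, Finset.sum_mul, Finset.sum_comm]
  refine Finset.sum_congr rfl fun c _ => ?_
  rw [Finset.mul_sum, Finset.sum_mul, Finset.sum_mul]
  refine Finset.sum_congr rfl fun b _ => ?_
  ring

lemma aux_tnorm_le {d : ℕ} (Y : Fin d → Fin d → Fin d → ℝ) (C : ℝ) (hC : 0 ≤ C)
    (H : ∀ u v w, l2norm u = 1 → l2norm v = 1 → l2norm w = 1 → |auxB Y u v w| ≤ C) :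
    tnorm Y ≤ C := by
  apply Real.sSup_le _ hC
  rintro a ⟨u, v, w, hu, hv, hw, rfl⟩
  exact H u v w hu hv hw

lemma aux_tnorm_nonneg {d : ℕ} (Y : Fin d → Fin d → Fin d → ℝ) : 0 ≤ tnorm Y := by
  apply Real.sSup_nonneg
  rintro a ⟨u, v, w, hu, hv, hw, rfl⟩
  exact abs_nonneg _

lemma aux_le_tnorm {d : ℕ} (Y : Fin d → Fin d → Fin d → ℝ) (u v w : Fin d → ℝ)
    (hu : l2norm u = 1) (hv : l2norm v = 1) (hw : l2norm w = 1) : |auxB Y u v w| ≤ tnorm Y := by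
  refine le_csSup ⟨∑ i1, ∑ i2, ∑ i3, |Y i1 i2 i3|, ?_⟩ ⟨u, v, w, hu, hv, hw, rfl⟩
  rintro a ⟨u, v, w, hu, hv, hw, rfl⟩
  refine (Finset.abs_sum_le_sum_abs _ _).trans (Finset.sum_le_sum fun i _ => ?_)
  refine (Finset.abs_sum_le_sum_abs _ _).trans (Finset.sum_le_sum fun j _ => ?_)
  refine (Finset.abs_sum_le_sum_abs _ _).trans (Finset.sum_le_sum fun l _ => ?_)
  have h1 := (aux_coord u i).trans_eq hu
  have h2 := (aux_coord v j).trans_eq hv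
  have h3 := (aux_coord w l).trans_eq hw
  rw [abs_mul, abs_mul, abs_mul]
  have h4 : |u i| * |v j| ≤ 1 := mul_le_one₀ h1 (abs_nonneg _) h2
  have h5 : |u i| * |v j| * |w l| ≤ 1 := mul_le_one₀ h4 (abs_nonneg _) h3
  exact mul_le_of_le_one_left (abs_nonneg _) h5

def auxT {d : ℕ} (m : Fin d → ℝ) : Fin d → Fin d → Fin d → ℝ := fun a b c =>
  m a * (if b = c then 1 else 0) + m b * (if a = c then 1 else 0) + m c * (if a = b then 1 else 0)

lemma aux_T {d : ℕ} (m : Fin d → ℝ) (e : Fin d → Fin d → ℝ) (he : ∀ j, e j = Pi.single j 1)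
    (a b c : Fin d) :
    ∑ j, (m a * e j b * e j c + e j a * m b * e j c + e j a * e j b * m c) = auxT m a b c := by
  have key : ∀ b c, ∑ j, e j b * e j c = if b = c then 1 else 0 := by
    intro b c
    simp [he, Pi.single_apply, eq_comm]
  unfold auxT
  rw [← key, ← key, ← key, Finset.mul_sum, Finset.mul_sum, Finset.mul_sum,
    ← Finset.sum_add_distrib, ← Finset.sum_add_distrib]
  exact Finset.sum_congr rfl fun j _ => by ring

lemma aux_B_T {d : ℕ} (m p q s : Fin d → ℝ) :
    auxB (auxT m) p q s = (m ⬝ᵥ p) * (q ⬝ᵥ s) + (m ⬝ᵥ q) * (p ⬝ᵥ s) + (m ⬝ᵥ s) * (p ⬝ᵥ q) := by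
  have e1 : ∑ i1, ∑ i2, ∑ i3, p i1 * q i2 * s i3 * (m i1 * (if i2 = i3 then (1:ℝ) else 0))
      = (m ⬝ᵥ p) * (q ⬝ᵥ s) := by
    simp only [dotProduct, Finset.sum_mul_sum, mul_ite, mul_one, mul_zero, Finset.sum_ite_eq,
      Finset.mem_univ, if_true]
    exact Finset.sum_congr rfl fun _ _ => Finset.sum_congr rfl fun _ _ => by ring
  have e2 : ∑ i1, ∑ i2, ∑ i3, p i1 * q i2 * s i3 * (m i2 * (if i1 = i3 then (1:ℝ) else 0))
      = (m ⬝ᵥ q) * (p ⬝ᵥ s) := by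
    rw [mul_comm]
    simp only [dotProduct, Finset.sum_mul_sum, mul_ite, mul_one, mul_zero, Finset.sum_ite_eq,
      Finset.mem_univ, if_true]
    exact Finset.sum_congr rfl fun _ _ => Finset.sum_congr rfl fun _ _ => by ring
  have e3 : ∑ i1, ∑ i2, ∑ i3, p i1 * q i2 * s i3 * (m i3 * (if i1 = i2 then (1:ℝ) else 0))
      = (m ⬝ᵥ s) * (p ⬝ᵥ q) := by
    rw [mul_comm]
    simp only [dotProduct, Finset.sum_mul_sum, mul_ite, mul_one, mul_zero]
    refine Finset.sum_congr rfl fun i _ => ?_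
    rw [Finset.sum_comm]
    refine Finset.sum_congr rfl fun _ _ => ?_
    simp only [Finset.sum_ite_eq, Finset.mem_univ, if_true]
    ring
  rw [← e1, ← e2, ← e3]
  simp only [auxB, auxT, mul_add, Finset.sum_add_distrib]

lemma aux_T_bound {d r : ℕ} (m : Fin d → ℝ) (R : Matrix (Fin d) (Fin r) ℝ) (u v w : Fin r → ℝ)
    (hu : l2norm u = 1) (hv : l2norm v = 1) (hw : l2norm w = 1) :
    |auxB (auxT m) (R *ᵥ u) (R *ᵥ v) (R *ᵥ w)| ≤ 3 * spec R ^ 2 * l2norm (Rᵀ *ᵥ m) := by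
  have hm : ∀ u, l2norm u = 1 → |m ⬝ᵥ (R *ᵥ u)| ≤ l2norm (Rᵀ *ᵥ m) := by
    intro u hu
    rw [Matrix.dotProduct_mulVec, ← Matrix.mulVec_transpose]
    simpa [hu] using aux_dot (Rᵀ *ᵥ m) u
  have hR : ∀ u, l2norm u = 1 → l2norm (R *ᵥ u) ≤ spec R := by
    intro u hu
    simpa [hu] using aux_spec R u
  have hq : ∀ u v, l2norm u = 1 → l2norm v = 1 → |(R *ᵥ u) ⬝ᵥ (R *ᵥ v)| ≤ spec R ^ 2 := by
    intro u v hu hv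
    refine (aux_dot _ _).trans ?_
    rw [sq]
    exact mul_le_mul (hR u hu) (hR v hv) (aux_l2_nonneg _) (aux_spec_nonneg _)
  have hp : ∀ u v w, l2norm u = 1 → l2norm v = 1 → l2norm w = 1 →
      |(m ⬝ᵥ (R *ᵥ u)) * ((R *ᵥ v) ⬝ᵥ (R *ᵥ w))| ≤ l2norm (Rᵀ *ᵥ m) * spec R ^ 2 := by
    intro u v w hu hv hw
    rw [abs_mul]
    exact mul_le_mul (hm u hu) (hq v w hv hw) (abs_nonneg _) (aux_l2_nonneg _)
  rw [aux_B_T]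
  refine (abs_add_three _ _ _).trans ?_
  linarith [hp u v w hu hv hw, hp v u w hv hu hw, hp w u v hw hu hv]

/-! Gaussian moments -/

lemma aux_memLp {d : ℕ} (m : Fin d → ℝ) (s : ℝ≥0) (a : Fin d) (p : ℝ≥0) :
    MemLp (fun y : Fin d → ℝ => y a) p (Measure.pi fun j => gaussianReal (m j) s) :=
  (memLp_id_gaussianReal p).comp_measurePreserving
    (measurePreserving_eval (fun j => gaussianReal (m j) s) a)

lemma aux_memLp' {d : ℕ} (m : Fin d → ℝ) (s : ℝ≥0) (a : Fin d) (p : ℝ≥0) :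
    MemLp (fun y : Fin d → ℝ => y a - m a) p (Measure.pi fun j => gaussianReal (m j) s) :=
  (aux_memLp m s a p).sub (memLp_const _)

lemma aux_int3 {α : Type*} [MeasurableSpace α] {ν : Measure α} {f g k : α → ℝ}
    (hf : MemLp f (4 : ℝ≥0) ν) (hg : MemLp g (4 : ℝ≥0) ν) (hk : MemLp k (2 : ℝ≥0) ν) :
    Integrable (fun y => f y * g y * k y) ν := by
  haveI : ENNReal.HolderTriple ((4 : ℝ≥0) : ENNReal) ((4 : ℝ≥0) : ENNReal) ((2 : ℝ≥0) : ENNReal) := by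
    constructor
    rw [← ENNReal.coe_inv (by norm_num), ← ENNReal.coe_inv (by norm_num), ← ENNReal.coe_add]
    norm_num
  have h1 : MemLp (f * g) ((2 : ℝ≥0) : ENNReal) ν := hg.mul hf
  have h2 := MemLp.integrable_mul (p := 2) (q := 2) (by simpa using h1) (by simpa using hk)
  exact h2

lemma aux_int2 {α : Type*} [MeasurableSpace α] {ν : Measure α} {f g : α → ℝ}
    (hf : MemLp f (2 : ℝ≥0) ν) (hg : MemLp g (2 : ℝ≥0) ν) :
    Integrable (fun y => f y * g y) ν :=
  MemLp.integrable_mul (p := 2) (q := 2) (by simpa using hf) (by simpa using hg)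

lemma aux_mean {d : ℕ} (m : Fin d → ℝ) (s : ℝ≥0) (a : Fin d) :
    ∫ y : Fin d → ℝ, y a ∂(Measure.pi fun j => gaussianReal (m j) s) = m a := by
  have := integral_comp_eval (μ := fun j => gaussianReal (m j) s) (i := a) (f := fun t : ℝ => t)
    (by fun_prop)
  rw [this]; simp

lemma aux_refl {d : ℕ} (m : Fin d → ℝ) (s : ℝ≥0) (t : Fin d → Prop) [DecidablePred t] :
    MeasurePreserving (fun (y : Fin d → ℝ) j => if t j then 2 * m j - y j else y j)
      (Measure.pi fun j => gaussianReal (m j) s) (Measure.pi fun j => gaussianReal (m j) s) := by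
  refine measurePreserving_pi _ _ (f := fun j z => if t j then 2 * m j - z else z) fun j => ?_
  by_cases h : t j
  · simp only [h, if_true]
    refine ⟨by fun_prop, ?_⟩
    rw [gaussianReal_map_const_sub]
    congr 1; ring
  · simp only [h, if_false]
    exact MeasurePreserving.id _

lemma aux_reflint {d : ℕ} (m : Fin d → ℝ) (s : ℝ≥0) (t : Fin d → Prop) [DecidablePred t]
    (f : (Fin d → ℝ) → ℝ) (hf : Measurable f)
    (hneg : ∀ y : Fin d → ℝ, f (fun j => if t j then 2 * m j - y j else y j) = - f y) :
    ∫ y, f y ∂(Measure.pi fun j => gaussianReal (m j) s) = 0 := by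
  have h := aux_refl m s t
  have h2 := integral_map (μ := Measure.pi fun j => gaussianReal (m j) s) h.measurable.aemeasurable
    (f := f) hf.aestronglyMeasurable
  rw [h.map_eq] at h2
  simp only [hneg, integral_neg] at h2
  linarith

lemma aux_cov {d : ℕ} (m : Fin d → ℝ) (s : ℝ≥0) (a b : Fin d) :
    ∫ y : Fin d → ℝ, (y a - m a) * (y b - m b) ∂(Measure.pi fun j => gaussianReal (m j) s)
      = (s : ℝ) * if a = b then 1 else 0 := by
  by_cases h : a = b
  · subst h
    have h1 := integral_comp_eval (μ := fun j => gaussianReal (m j) s) (i := a)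
      (f := fun t : ℝ => (t - m a) * (t - m a)) (by fun_prop)
    have h2 := variance_eq_integral (μ := gaussianReal (m a) s) (X := id) (by fun_prop)
    rw [variance_id_gaussianReal] at h2
    rw [h1]
    simp only [id, integral_id_gaussianReal, sq] at h2
    simp [← h2]
  · simp only [h, if_false, mul_zero]
    refine aux_reflint m s (fun j => j = a) _ (by fun_prop) fun y => ?_
    have : b ≠ a := fun h' => h h'.symm
    simp only [this, if_true, if_false]
    ring

lemma aux_third {d : ℕ} (m : Fin d → ℝ) (s : ℝ≥0) (a b c : Fin d) :
    ∫ y : Fin d → ℝ, (y a - m a) * (y b - m b) * (y c - m c)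
      ∂(Measure.pi fun j => gaussianReal (m j) s) = 0 := by
  refine aux_reflint m s (fun _ => True) _ (by fun_prop) fun y => ?_
  simp only [if_true]
  ring

lemma aux_mom {d : ℕ} (m : Fin d → ℝ) (s : ℝ≥0) (a b c : Fin d) :
    ∫ y : Fin d → ℝ, y a * y b * y c ∂(Measure.pi fun j => gaussianReal (m j) s)
      = m a * m b * m c + (s : ℝ) * auxT m a b c := by
  set ν := Measure.pi fun j => gaussianReal (m j) s with hν
  have i3 : Integrable (fun y : Fin d → ℝ => (y a - m a) * (y b - m b) * (y c - m c)) ν :=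
    aux_int3 (aux_memLp' m s a 4) (aux_memLp' m s b 4) (aux_memLp' m s c 2)
  have i2 : ∀ k a b, Integrable (fun y : Fin d → ℝ => k * ((y a - m a) * (y b - m b))) ν :=
    fun k a b => (aux_int2 (aux_memLp' m s a 2) (aux_memLp' m s b 2)).const_mul k
  have i1 : ∀ k a, Integrable (fun y : Fin d → ℝ => k * y a) ν := fun k a => by
    have := aux_memLp m s a 1
    exact (memLp_one_iff_integrable.1 (by simpa using this)).const_mul k
  have e : ∀ y : Fin d → ℝ, y a * y b * y c = (y a - m a) * (y b - m b) * (y c - m c)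
      + m a * ((y b - m b) * (y c - m c)) + m b * ((y a - m a) * (y c - m c))
      + m c * ((y a - m a) * (y b - m b))
      + (m b * m c) * y a + (m a * m c) * y b + (m a * m b) * y c - 2 * m a * m b * m c := by
    intro y; ring
  rw [integral_congr_ae (Filter.Eventually.of_forall e)]
  rw [integral_sub (by fun_prop) (by fun_prop), integral_add (by fun_prop) (by fun_prop),
    integral_add (by fun_prop) (by fun_prop), integral_add (by fun_prop) (by fun_prop),
    integral_add (by fun_prop) (by fun_prop), integral_add (by fun_prop) (by fun_prop),
    integral_add (by fun_prop) (by fun_prop)]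
  simp only [integral_const_mul, hν, aux_third, aux_cov, aux_mean, integral_const]
  simp only [auxT, probReal_univ, smul_eq_mul]
  ring

lemma aux_mix {Ω : Type} [MeasurableSpace Ω] (P : Measure Ω) [IsProbabilityMeasure P]
    (d k : ℕ) (w : Fin k → ℝ) (μ : Fin k → Fin d → ℝ) (σ2 : ℝ≥0)
    (h : Ω → Fin k) (x : Ω → Fin d → ℝ)
    (hmeas_h : Measurable h) (hmeas_x : Measurable x)
    (hw_pos : ∀ i, 0 < w i)
    (hprob : ∀ i, P (h ⁻¹' {i}) = ENNReal.ofReal (w i))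
    (hcond : ∀ i, (ProbabilityTheory.cond P (h ⁻¹' {i})).map x
        = Measure.pi fun j => ProbabilityTheory.gaussianReal (μ i j) σ2)
    (g : (Fin d → ℝ) → ℝ) (hg : Measurable g)
    (hi : ∀ i, Integrable g (Measure.pi fun j => gaussianReal (μ i j) σ2)) :
    ∫ ω, g (x ω) ∂P = ∑ i, w i * ∫ y, g y ∂(Measure.pi fun j => gaussianReal (μ i j) σ2) := by
  have hP := sum_meas_smul_cond_fiber hmeas_h P
  conv_lhs => rw [← hP]
  rw [integral_finset_sum_measure]
  · refine Finset.sum_congr rfl fun i _ => ?_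
    rw [integral_smul_measure, hprob, ENNReal.toReal_ofReal (hw_pos i).le, ← hcond,
      integral_map hmeas_x.aemeasurable hg.aestronglyMeasurable, smul_eq_mul]
  · intro i _
    refine Integrable.smul_measure ?_ (by rw [hprob]; simp)
    have := hi i
    rw [← hcond] at this
    exact (integrable_map_measure hg.aestronglyMeasurable hmeas_x.aemeasurable).1 this

end helpers

/-- **Accuracy of `M̂₃`.**
In the mixture of spherical Gaussians model with common variance `σ²`, with `μ = E[x]`,
`Σ₂ = E[xxᵀ]`, `Σ₃ = E[x⊗x⊗x]`, and `M₃ = ∑ i, w i μ_i⊗μ_i⊗μ_i`, one has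
`M₃ = Σ₃ − σ² ∑_j (μ⊗e_j⊗e_j + e_j⊗μ⊗e_j + e_j⊗e_j⊗μ)`; and for any `μ̂`, `Σ̂₃`, and
`σ̂²` satisfying `|σ̂² − σ²| ≤ ‖Σ̂₂ − Σ₂‖₂ + 2‖μ‖₂‖μ̂ − μ‖₂ + ‖μ̂ − μ‖₂²`, setting
`M̂₃ := Σ̂₃ − σ̂² ∑_j (μ̂⊗e_j⊗e_j + e_j⊗μ̂⊗e_j + e_j⊗e_j⊗μ̂)`, for any `R ∈ ℝ^{d×r}`:
`‖(M̂₃ − M₃)[R,R,R]‖₂ ≤ ‖(Σ̂₃ − Σ₃)[R,R,R]‖₂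
  + 3‖R‖₂²(‖Rᵀ(μ̂ − μ)‖₂ + ‖Rᵀμ‖₂)(‖Σ̂₂ − Σ₂‖₂ + 2‖μ‖₂‖μ̂ − μ‖₂ + ‖μ̂ − μ‖₂²)
  + 3σ²‖R‖₂²‖Rᵀ(μ̂ − μ)‖₂`. -/
theorem accuracy_M3
    {Ω : Type} [MeasurableSpace Ω] (P : Measure Ω) [IsProbabilityMeasure P]
    (d k r : ℕ)
    (w : Fin k → ℝ) (μ : Fin k → Fin d → ℝ) (σ2 : ℝ≥0)
    (h : Ω → Fin k) (x : Ω → Fin d → ℝ)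
    (hmeas_h : Measurable h) (hmeas_x : Measurable x)
    (hw_pos : ∀ i, 0 < w i) (hw_sum : ∑ i, w i = 1)
    (hprob : ∀ i, P (h ⁻¹' {i}) = ENNReal.ofReal (w i))
    (hcond : ∀ i, (ProbabilityTheory.cond P (h ⁻¹' {i})).map x
        = Measure.pi fun j => ProbabilityTheory.gaussianReal (μ i j) σ2)
    -- population quantities
    (μbar : Fin d → ℝ) (hμbar : ∀ i, μbar i = ∫ ω, x ω i ∂P)
    (S2 : Matrix (Fin d) (Fin d) ℝ)
    (hS2 : S2 = Matrix.of fun i j => ∫ ω, x ω i * x ω j ∂P)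
    (S3 : Fin d → Fin d → Fin d → ℝ)
    (hS3 : ∀ a b c, S3 a b c = ∫ ω, x ω a * x ω b * x ω c ∂P)
    (M3 : Fin d → Fin d → Fin d → ℝ)
    (hM3 : ∀ a b c, M3 a b c = ∑ i, w i * (μ i a * μ i b * μ i c))
    (e : Fin d → Fin d → ℝ) (he : ∀ j, e j = Pi.single j 1)
    -- plug-in quantities
    (μhat : Fin d → ℝ) (S2hat : Matrix (Fin d) (Fin d) ℝ) (hS2hat : S2hat.IsHermitian)
    (S3hat : Fin d → Fin d → Fin d → ℝ)
    (σ2hat : ℝ)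
    (hσ2hat : |σ2hat - (σ2 : ℝ)| ≤
        spec (S2hat - S2) + 2 * l2norm μbar * l2norm (μhat - μbar)
          + l2norm (μhat - μbar) ^ 2)
    (M3hat : Fin d → Fin d → Fin d → ℝ)
    (hM3hat : ∀ a b c, M3hat a b c = S3hat a b c
        - σ2hat * ∑ j, (μhat a * e j b * e j c + e j a * μhat b * e j c
            + e j a * e j b * μhat c))
    (R : Matrix (Fin d) (Fin r) ℝ) :
    -- structure of `M₃`
    (∀ a b c, M3 a b c = S3 a b c
        - (σ2 : ℝ) * ∑ j, (μbar a * e j b * e j c + e j a * μbar b * e j c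
            + e j a * e j b * μbar c)) ∧
    -- accuracy of `M̂₃`
    tnorm (tmap3 (M3hat - M3) R R R) ≤
      tnorm (tmap3 (S3hat - S3) R R R)
      + 3 * spec R ^ 2 * (l2norm (Rᵀ *ᵥ (μhat - μbar)) + l2norm (Rᵀ *ᵥ μbar))
          * (spec (S2hat - S2) + 2 * l2norm μbar * l2norm (μhat - μbar)
              + l2norm (μhat - μbar) ^ 2)
      + 3 * (σ2 : ℝ) * spec R ^ 2 * l2norm (Rᵀ *ᵥ (μhat - μbar)) := by
  have part1 : ∀ a b c, M3 a b c = S3 a b c - (σ2 : ℝ) * auxT μbar a b c := by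
    intro a b c
    have hm : ∀ a, μbar a = ∑ i, w i * μ i a := by
      intro a
      rw [hμbar, aux_mix P d k w μ σ2 h x hmeas_h hmeas_x hw_pos hprob hcond (fun y => y a)
        (by fun_prop) (fun i => memLp_one_iff_integrable.1 (by simpa using aux_memLp (μ i) σ2 a 1))]
      simp only [aux_mean]
    rw [hM3, hS3, aux_mix P d k w μ σ2 h x hmeas_h hmeas_x hw_pos hprob hcond
      (fun y => y a * y b * y c) (by fun_prop)
      (fun i => aux_int3 (aux_memLp (μ i) σ2 a 4) (aux_memLp (μ i) σ2 b 4)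
        (aux_memLp (μ i) σ2 c 2))]
    simp only [aux_mom, auxT, hm, Finset.sum_mul, Finset.mul_sum, ← Finset.sum_add_distrib,
      ← Finset.sum_sub_distrib]
    exact Finset.sum_congr rfl fun i _ => by ring
  simp only [aux_T _ e he] at hM3hat ⊢
  refine ⟨part1, ?_⟩
  set D := spec (S2hat - S2) + 2 * l2norm μbar * l2norm (μhat - μbar)
          + l2norm (μhat - μbar) ^ 2 with hD
  have hD0 : 0 ≤ D := (abs_nonneg _).trans hσ2hat
  have n1 := aux_l2_nonneg (Rᵀ *ᵥ (μhat - μbar))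
  have n2 := aux_l2_nonneg (Rᵀ *ᵥ μbar)
  have n3 := aux_tnorm_nonneg (tmap3 (S3hat - S3) R R R)
  have n4 := aux_spec_nonneg R
  refine aux_tnorm_le _ _ (by positivity) fun u v z hu hv hz => ?_
  have t0 := aux_le_tnorm (tmap3 (S3hat - S3) R R R) u v z hu hv hz
  have t1 := aux_T_bound μhat R u v z hu hv hz
  have t2 := aux_T_bound (μhat - μbar) R u v z hu hv hz
  have t3 : l2norm (Rᵀ *ᵥ μhat) ≤ l2norm (Rᵀ *ᵥ (μhat - μbar)) + l2norm (Rᵀ *ᵥ μbar) := by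
    have := aux_l2_add (Rᵀ *ᵥ (μhat - μbar)) (Rᵀ *ᵥ μbar)
    rwa [← Matrix.mulVec_add, sub_add_cancel] at this
  rw [aux_B_map] at t0 ⊢
  have key : auxB (M3hat - M3) (R *ᵥ u) (R *ᵥ v) (R *ᵥ z)
      = auxB (S3hat - S3) (R *ᵥ u) (R *ᵥ v) (R *ᵥ z)
        + (-((σ2hat - σ2) * auxB (auxT μhat) (R *ᵥ u) (R *ᵥ v) (R *ᵥ z)))
        + (-(σ2 * auxB (auxT (μhat - μbar)) (R *ᵥ u) (R *ᵥ v) (R *ᵥ z))) := by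
    simp only [auxB, Finset.mul_sum, ← Finset.sum_neg_distrib, ← Finset.sum_add_distrib]
    refine Finset.sum_congr rfl fun a _ => Finset.sum_congr rfl fun b _ =>
      Finset.sum_congr rfl fun c _ => ?_
    simp only [Pi.sub_apply, hM3hat, part1, auxT]
    ring
  rw [key]
  refine (abs_add_three _ _ _).trans ?_
  rw [abs_neg, abs_neg, abs_mul, abs_mul, abs_of_nonneg σ2.coe_nonneg]
  have b1 : |σ2hat - σ2| * |auxB (auxT μhat) (R *ᵥ u) (R *ᵥ v) (R *ᵥ z)|
      ≤ D * (3 * spec R ^ 2 * (l2norm (Rᵀ *ᵥ (μhat - μbar)) + l2norm (Rᵀ *ᵥ μbar))) := by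
    refine mul_le_mul hσ2hat (t1.trans ?_) (abs_nonneg _) hD0
    exact mul_le_mul_of_nonneg_left t3 (by positivity)
  have b2 := mul_le_mul_of_nonneg_left t2 σ2.coe_nonneg
  linarith
end
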